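/- Let G be a finite simple graph and M a matching in G whose shortest M-augmenting path has length ℓ. Let P be a maximal set of pairwise vertex-disjoint M-augmenting paths of length ℓ (i.e., no further M-augmenting path of length ℓ is vertex-disjoint from all paths in P), and let M' = M ⊕ (⋃_{P∈P} E(P)). Then every M'-augmenting path in G has length strictly greater than ℓ. -/

import Mathlib

open scoped symmDiff

variable {V : Type*}

/-- `M` is a matching in the simple graph `G`: a set of edges of `G`,
no two of which share a vertex. -/
def IsMatchingOn (G : SimpleGraph V) (M : Finset (Sym2 V)) : Prop :=
  ↑M ⊆ G.edgeSet ∧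
    ∀ e ∈ M, ∀ f ∈ M, e ≠ f → ∀ v : V, v ∈ e → v ∉ f

/-- A vertex is free (with respect to the edge set `M`) if it lies on no edge of `M`. -/
def IsFreeVertex (M : Finset (Sym2 V)) (v : V) : Prop :=
  ∀ e ∈ M, v ∉ e

/-- The edges of the walk `p` alternate between edges not in `M` and edges in `M`,
starting (and, when the final vertex is free, ending) with an edge not in `M`:
the `i`-th edge lies in `M` exactly when `i` is odd. -/
def IsAlternatingWalk (M : Finset (Sym2 V)) {G : SimpleGraph V} {u v : V}
    (p : G.Walk u v) : Prop :=
  ∀ (i : ℕ) (h : i < p.edges.length), (p.edges.get ⟨i, h⟩ ∈ M ↔ i % 2 = 1)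

/-- An `M`-augmenting path in `G`: a path between two distinct free vertices whose
edges alternate between edges not in `M` and edges in `M`, starting and ending
with edges not in `M`. -/
def IsAugmentingPath (G : SimpleGraph V) (M : Finset (Sym2 V)) {u v : V}
    (p : G.Walk u v) : Prop :=
  p.IsPath ∧ u ≠ v ∧ IsFreeVertex M u ∧ IsFreeVertex M v ∧ IsAlternatingWalk M p

lemma countP_alternating {α : Type*} (L : List α) (P : α → Bool)
    (h : ∀ (i : ℕ) (hi : i < L.length), P L[i] = true ↔ i % 2 = 1) :
    L.countP P = L.length / 2 := by
  induction L using List.reverseRecOn with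
  | nil => simp
  | append_singleton L a ih =>
    have hL := ih fun i hi => by
      have := h i (by simp; omega)
      rwa [List.getElem_append_left hi] at this
    have ha := h L.length (by simp)
    simp only [List.getElem_append_right le_rfl, Nat.sub_self, List.getElem_cons_zero] at ha
    rw [List.countP_append, hL, List.countP_singleton, List.length_append, List.length_singleton]
    by_cases hPa : P a = true
    · have := ha.1 hPa
      simp only [hPa, if_true]
      omega
    · have := mt ha.2 hPa
      simp only [hPa]
      simp
      omega

lemma IsAlternatingWalk.getVert_mem_iff {M : Finset (Sym2 V)} {G : SimpleGraph V} {u v : V}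
    {p : G.Walk u v} (hp : IsAlternatingWalk M p) {i : ℕ} (hi : i < p.length) :
    s(p.getVert i, p.getVert (i + 1)) ∈ M ↔ i % 2 = 1 := by
  have h : i < p.edges.length := by simpa using hi
  rw [← SimpleGraph.Walk.getElem_edges h]
  exact hp i h

lemma mem_edges_getVert {G : SimpleGraph V} {u v : V} (p : G.Walk u v) {i : ℕ}
    (hi : i < p.length) : s(p.getVert i, p.getVert (i + 1)) ∈ p.edges := by
  have h : i < p.edges.length := by simpa using hi
  rw [← SimpleGraph.Walk.getElem_edges h]
  exact List.getElem_mem h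

lemma exists_getVert_of_mem_edges {G : SimpleGraph V} {u v : V} {p : G.Walk u v} {e : Sym2 V}
    (he : e ∈ p.edges) : ∃ i < p.length, e = s(p.getVert i, p.getVert (i + 1)) := by
  obtain ⟨i, hi, rfl⟩ := List.mem_iff_getElem.1 he
  exact ⟨i, by simpa using hi, SimpleGraph.Walk.getElem_edges hi⟩

section AugmentingPath

variable {G : SimpleGraph V} {M : Finset (Sym2 V)} {u v : V} {p : G.Walk u v}

lemma IsAugmentingPath.length_odd (hp : IsAugmentingPath G M p) : p.length % 2 = 1 := by
  obtain ⟨-, hne, -, hv, halt⟩ := hp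
  have hpos : p.length ≠ 0 := fun h => hne (SimpleGraph.Walk.eq_of_length_eq_zero h)
  have hlast := halt.getVert_mem_iff (i := p.length - 1) (by omega)
  rw [Nat.sub_add_cancel (by omega), p.getVert_length] at hlast
  have : s(p.getVert (p.length - 1), v) ∉ M := fun h => hv _ h (by simp)
  have := mt hlast.2 this
  omega

/-- Every vertex of an augmenting path lies on an unmatched edge of the path. -/
lemma IsAugmentingPath.exists_edge_notMem (hp : IsAugmentingPath G M p) {w : V}
    (hw : w ∈ p.support) : ∃ e ∈ p.edges, e ∉ M ∧ w ∈ e := by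
  obtain ⟨i, rfl, hi⟩ := SimpleGraph.Walk.mem_support_iff_exists_getVert.1 hw
  have hodd := hp.length_odd
  rcases Nat.mod_two_eq_zero_or_one i with h | h
  · refine ⟨_, mem_edges_getVert p (i := i) (by omega), ?_, by simp⟩
    rw [hp.2.2.2.2.getVert_mem_iff (by omega)]
    omega
  · obtain ⟨j, rfl⟩ : ∃ j, i = j + 1 := ⟨i - 1, by omega⟩
    refine ⟨_, mem_edges_getVert p (i := j) (by omega), ?_, by simp⟩
    rw [hp.2.2.2.2.getVert_mem_iff (by omega)]
    omega

/-- Every vertex of an augmenting path is free or lies on a matched edge of the path. -/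
lemma IsAugmentingPath.isFreeVertex_or_exists_edge_mem (hp : IsAugmentingPath G M p) {w : V}
    (hw : w ∈ p.support) : IsFreeVertex M w ∨ ∃ e ∈ p.edges, e ∈ M ∧ w ∈ e := by
  obtain ⟨i, rfl, hi⟩ := SimpleGraph.Walk.mem_support_iff_exists_getVert.1 hw
  have hodd := hp.length_odd
  obtain ⟨-, -, hu, hv, halt⟩ := hp
  rcases Nat.mod_two_eq_zero_or_one i with h | h
  · rcases Nat.eq_zero_or_pos i with rfl | hpos
    · left
      simpa using hu
    · obtain ⟨j, rfl⟩ : ∃ j, i = j + 1 := ⟨i - 1, by omega⟩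
      refine .inr ⟨_, mem_edges_getVert p (i := j) (by omega), ?_, by simp⟩
      rw [halt.getVert_mem_iff (by omega)]
      omega
  · rcases hi.eq_or_lt with rfl | hlt
    · left
      simpa using hv
    · refine .inr ⟨_, mem_edges_getVert p (i := i) hlt, ?_, by simp⟩
      rwa [halt.getVert_mem_iff hlt]

/-- The unmatched edges of an augmenting path are pairwise disjoint. -/
lemma IsAugmentingPath.eq_of_notMem (hp : IsAugmentingPath G M p) {e f : Sym2 V}
    (he : e ∈ p.edges) (hf : f ∈ p.edges) (heM : e ∉ M) (hfM : f ∉ M) {w : V}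
    (hwe : w ∈ e) (hwf : w ∈ f) : e = f := by
  obtain ⟨i, hi, rfl⟩ := exists_getVert_of_mem_edges he
  obtain ⟨j, hj, rfl⟩ := exists_getVert_of_mem_edges hf
  rw [hp.2.2.2.2.getVert_mem_iff hi] at heM
  rw [hp.2.2.2.2.getVert_mem_iff hj] at hfM
  have hinj : ∀ a b, a ≤ p.length → b ≤ p.length → p.getVert a = p.getVert b → a = b :=
    fun a b ha hb h => hp.1.getVert_injOn ha hb h
  obtain rfl : i = j := by
    rw [Sym2.mem_iff] at hwe hwf
    rcases hwe with rfl | rfl <;> rcases hwf with h | h <;>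
      · have := hinj _ _ (by omega) (by omega) h
        omega
  rfl

lemma IsAugmentingPath.reverse (hp : IsAugmentingPath G M p) :
    IsAugmentingPath G M p.reverse := by
  have hodd := hp.length_odd
  obtain ⟨hpath, hne, hu, hv, halt⟩ := hp
  refine ⟨hpath.reverse, hne.symm, hv, hu, fun i h => ?_⟩
  have h' : i < p.length := by simpa using h
  have := halt (p.edges.length - 1 - i) (by simp; omega)
  simp only [List.get_eq_getElem, SimpleGraph.Walk.edges_reverse, List.getElem_reverse] at this ⊢
  rw [this, SimpleGraph.Walk.length_edges]
  omega

lemma IsAugmentingPath.congr {M' : Finset (Sym2 V)} (hp : IsAugmentingPath G M p)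
    (hu : IsFreeVertex M' u) (hv : IsFreeVertex M' v) (h : ∀ e ∈ p.edges, e ∈ M' ↔ e ∈ M) :
    IsAugmentingPath G M' p :=
  ⟨hp.1, hp.2.1, hu, hv, fun i hi => (h _ (List.get_mem _ _)).trans (hp.2.2.2.2 i hi)⟩

variable [DecidableEq V]

/-- Switching edges away from an augmenting path keeps it augmenting. -/
lemma IsAugmentingPath.symmDiff_of_disjoint (hp : IsAugmentingPath G M p)
    {F : Finset (Sym2 V)} (hF : ∀ e ∈ F, ∀ w ∈ e, w ∉ p.support) :
    IsAugmentingPath G (M ∆ F) p := by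
  have hfree : ∀ w ∈ p.support, IsFreeVertex M w → IsFreeVertex (M ∆ F) w := by
    intro w hw hfree e he hwe
    rcases Finset.mem_symmDiff.1 he with h | h
    · exact hfree e h.1 hwe
    · exact hF e h.1 w hwe hw
  refine hp.congr (hfree u (by simp) hp.2.2.1) (hfree v (by simp) hp.2.2.2.1) fun e he => ?_
  have : e ∉ F := by
    intro heF
    obtain ⟨i, hi, rfl⟩ := exists_getVert_of_mem_edges he
    exact hF _ heF (p.getVert i) (by simp) (p.getVert_mem_support i)
  simp [Finset.mem_symmDiff, this]

lemma IsAugmentingPath.card_edges (hp : IsAugmentingPath G M p) :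
    p.edges.toFinset.card = p.length := by
  rw [List.toFinset_card_of_nodup hp.1.isTrail.edges_nodup, SimpleGraph.Walk.length_edges]

lemma IsAugmentingPath.card_edges_sdiff (hp : IsAugmentingPath G M p) :
    (p.edges.toFinset \ M).card = (p.edges.toFinset ∩ M).card + 1 := by
  have hodd := hp.length_odd
  have hcount := countP_alternating p.edges (fun e => decide (e ∈ M))
    (fun i hi => by simpa using hp.2.2.2.2 i hi)
  have hinter : (p.edges.toFinset ∩ M).card = p.edges.countP (fun e => decide (e ∈ M)) := by
    rw [List.countP_eq_length_filter, ← List.toFinset_card_of_nodup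
      (hp.1.isTrail.edges_nodup.filter _), List.toFinset_filter]
    congr 1
    ext e
    simp
  have := Finset.card_sdiff_add_card_inter p.edges.toFinset M
  rw [hp.card_edges] at this
  rw [SimpleGraph.Walk.length_edges] at hcount
  omega

end AugmentingPath

section Matching

variable {G : SimpleGraph V} {M N F : Finset (Sym2 V)}

lemma IsMatchingOn.eq_of_mem (hM : IsMatchingOn G M) {e f : Sym2 V} (he : e ∈ M) (hf : f ∈ M)
    {w : V} (hwe : w ∈ e) (hwf : w ∈ f) : e = f := by
  by_contra hne
  exact hM.2 e he f hf hne w hwe hwf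

lemma IsMatchingOn.subset (hM : IsMatchingOn G M) (h : N ⊆ M) : IsMatchingOn G N :=
  ⟨fun _ he => hM.1 (h he), fun e he f hf => hM.2 e (h he) f (h hf)⟩

lemma IsFreeVertex.subset {w : V} (h : IsFreeVertex M w) (hNM : N ⊆ M) : IsFreeVertex N w :=
  fun e he => h e (hNM he)

variable [DecidableEq V]

/-- Switching a matching `M` along `F` gives a matching, as soon as the added edges are
pairwise disjoint and `F` contains every edge of `M` meeting them. -/
lemma IsMatchingOn.symmDiff (hM : IsMatchingOn G M) (hFG : ∀ e ∈ F, e ∈ G.edgeSet)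
    (hF : ∀ e ∈ F, ∀ f ∈ F, e ∉ M → f ∉ M → ∀ w, w ∈ e → w ∈ f → e = f)
    (hFM : ∀ e ∈ F, e ∉ M → ∀ w ∈ e, ∀ f ∈ M, w ∈ f → f ∈ F) :
    IsMatchingOn G (M ∆ F) := by
  refine ⟨fun e he => ?_, fun e he f hf hne w hwe hwf => hne ?_⟩
  · rcases Finset.mem_symmDiff.1 he with h | h
    · exact hM.1 h.1
    · exact hFG e h.1
  · rcases Finset.mem_symmDiff.1 he with h | h <;> rcases Finset.mem_symmDiff.1 hf with h' | h'
    · exact hM.eq_of_mem h.1 h'.1 hwe hwf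
    · exact absurd (hFM f h'.1 h'.2 w hwf e h.1 hwe) h.2
    · exact absurd (hFM e h.1 h.2 w hwe f h'.1 hwf) h'.2
    · exact hF e h.1 f h'.1 h.2 h'.2 w hwe hwf

lemma card_symmDiff_add_card_inter (A B : Finset (Sym2 V)) :
    (A ∆ B).card + (B ∩ A).card = A.card + (B \ A).card := by
  have h1 : (A ∆ B).card = (A \ B).card + (B \ A).card :=
    Finset.card_union_of_disjoint disjoint_sdiff_sdiff
  have h2 := Finset.card_sdiff_add_card_inter A B
  rw [Finset.inter_comm] at h2
  omega

lemma IsMatchingOn.augment (hM : IsMatchingOn G M) {u v : V} {p : G.Walk u v}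
    (hp : IsAugmentingPath G M p) :
    IsMatchingOn G (M ∆ p.edges.toFinset) ∧ (M ∆ p.edges.toFinset).card = M.card + 1 := by
  constructor
  · refine hM.symmDiff (fun e he => p.edges_subset_edgeSet (List.mem_toFinset.1 he))
      (fun e he f hf heM hfM w hwe hwf => hp.eq_of_notMem (List.mem_toFinset.1 he)
        (List.mem_toFinset.1 hf) heM hfM hwe hwf) fun e he heM w hwe f hf hwf => ?_
    have hw : w ∈ p.support :=
      SimpleGraph.Walk.mem_support_of_mem_edges (List.mem_toFinset.1 he) hwe
    rcases hp.isFreeVertex_or_exists_edge_mem hw with h | ⟨g, hg, hgM, hwg⟩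
    · exact absurd hwf (h f hf)
    · rw [hM.eq_of_mem hf hgM hwf hwg]
      exact List.mem_toFinset.2 hg
  · have := card_symmDiff_add_card_inter M p.edges.toFinset
    have := hp.card_edges_sdiff
    omega

/-- Switching `N` along an `M`-augmenting path inside `M ∆ N` removes one edge from `N`. -/
lemma IsMatchingOn.reduce (hM : IsMatchingOn G M) (hN : IsMatchingOn G N) {u v : V}
    {p : G.Walk u v} (hp : IsAugmentingPath G M p) (hpMN : ∀ e ∈ p.edges, e ∈ M ∆ N) :
    IsMatchingOn G (N ∆ p.edges.toFinset) ∧ (N ∆ p.edges.toFinset).card + 1 = N.card := by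
  have hiff : ∀ e ∈ p.edges, e ∈ N ↔ e ∉ M := by
    intro e he
    have := Finset.mem_symmDiff.1 (hpMN e he)
    tauto
  constructor
  · refine hN.symmDiff (fun e he => p.edges_subset_edgeSet (List.mem_toFinset.1 he))
      (fun e he f hf heN hfN w hwe hwf => ?_) fun e he heN w hwe f hf hwf => ?_
    · rw [List.mem_toFinset] at he hf
      rw [hiff e he, not_not] at heN
      rw [hiff f hf, not_not] at hfN
      exact hM.eq_of_mem heN hfN hwe hwf
    · obtain ⟨g, hg, hgM, hwg⟩ := hp.exists_edge_notMem
        (SimpleGraph.Walk.mem_support_of_mem_edges (List.mem_toFinset.1 he) hwe)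
      rw [hN.eq_of_mem hf ((hiff g hg).2 hgM) hwf hwg]
      exact List.mem_toFinset.2 hg
  · have h1 : p.edges.toFinset \ N = p.edges.toFinset ∩ M := by
      ext e
      simp only [Finset.mem_sdiff, Finset.mem_inter, List.mem_toFinset]
      have := hiff e
      tauto
    have h2 : p.edges.toFinset ∩ N = p.edges.toFinset \ M := by
      ext e
      simp only [Finset.mem_sdiff, Finset.mem_inter, List.mem_toFinset]
      have := hiff e
      tauto
    have h3 := card_symmDiff_add_card_inter N p.edges.toFinset
    rw [h1, h2] at h3
    have := hp.card_edges_sdiff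
    omega

lemma IsMatchingOn.card_covered (hM : IsMatchingOn G M) :
    (M.biUnion Sym2.toFinset).card = 2 * M.card := by
  rw [Finset.card_biUnion, Finset.sum_const_nat (m := 2), mul_comm]
  · exact fun e he => Sym2.card_toFinset_of_not_isDiag e (G.not_isDiag_of_mem_edgeSet (hM.1 he))
  · intro e he f hf hne
    refine Finset.disjoint_left.2 fun w hwe hwf => ?_
    exact hM.2 e he f hf hne w (by simpa using hwe) (by simpa using hwf)

lemma IsMatchingOn.exists_covered_isFreeVertex (hM : IsMatchingOn G M) (hN : IsMatchingOn G N)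
    (hcard : M.card < N.card) : ∃ u v, s(u, v) ∈ N ∧ IsFreeVertex M u := by
  have hlt : (M.biUnion Sym2.toFinset).card < (N.biUnion Sym2.toFinset).card := by
    rw [hM.card_covered, hN.card_covered]
    omega
  obtain ⟨u, huN, huM⟩ := Finset.exists_mem_notMem_of_card_lt_card hlt
  simp only [Finset.mem_biUnion, Sym2.mem_toFinset, not_exists, not_and] at huN huM
  obtain ⟨e, he, hue⟩ := huN
  obtain ⟨v, rfl⟩ := Sym2.mem_iff_exists.1 hue
  exact ⟨u, v, he, huM⟩

lemma IsMatchingOn.isFreeVertex_erase (hM : IsMatchingOn G M) {e : Sym2 V} (he : e ∈ M) {w : V}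
    (hw : w ∈ e) : IsFreeVertex (M.erase e) w := fun _ hf hwf =>
  (Finset.mem_erase.1 hf).1 (hM.eq_of_mem (Finset.mem_erase.1 hf).2 he hwf hw)

/-- A path augmenting for `M` minus the edge `s(v, w)`, which starts at `w` and avoids `u` and
`v`, can be prolonged through `v` to an `M`-free vertex `u`. -/
lemma IsAugmentingPath.cons_cons {u v w y : V} {q : G.Walk w y}
    (hvw : s(v, w) ∈ M) (hq : IsAugmentingPath G (M.erase s(v, w)) q)
    (huv : G.Adj u v) (hvw' : G.Adj v w) (huM : IsFreeVertex M u) (hyM : IsFreeVertex M y)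
    (hu : u ∉ q.support) (hv : v ∉ q.support) :
    IsAugmentingPath G M (.cons huv (.cons hvw' q)) := by
  refine ⟨?_, fun h => hu (h ▸ q.end_mem_support), huM, hyM, fun i hi => ?_⟩
  · simp only [SimpleGraph.Walk.cons_isPath_iff, SimpleGraph.Walk.support_cons, List.mem_cons,
      not_or]
    exact ⟨⟨hq.1, hv⟩, huv.ne, hu⟩
  · match i with
    | 0 =>
      have : s(u, v) ∉ M := fun h => huM _ h (by simp)
      simpa using this
    | 1 => simpa using hvw
    | i + 2 =>
      have hi' : i < q.edges.length := by simpa using hi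
      have h := hq.2.2.2.2 i hi'
      have hne : q.edges[i] ≠ s(v, w) := by
        intro h
        exact hv (q.fst_mem_support_of_mem_edges (h ▸ List.getElem_mem hi'))
      simp only [List.get_eq_getElem, Finset.mem_erase, ne_eq, hne, not_false_eq_true,
        true_and] at h
      simpa using h

/-- Berge's theorem: if `N` is a larger matching than `M`, then some `M`-augmenting path
uses only edges of `M ∆ N`. -/
lemma exists_isAugmentingPath_of_card_lt (hM : IsMatchingOn G M) (hN : IsMatchingOn G N)
    (hcard : M.card < N.card) :
    ∃ (u v : V) (q : G.Walk u v), IsAugmentingPath G M q ∧ ∀ e ∈ q.edges, e ∈ M ∆ N := by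
  induction hn : N.card using Nat.strong_induction_on generalizing M N with
  | _ n ih =>
  subst hn
  obtain ⟨u, v, huvN, huM⟩ := hM.exists_covered_isFreeVertex hN hcard
  have huv : G.Adj u v := hN.1 huvN
  have huvM : s(u, v) ∉ M := fun h => huM _ h (by simp)
  by_cases hvM : IsFreeVertex M v
  · refine ⟨u, v, huv.toWalk, ⟨by simp [huv.ne], huv.ne, huM, hvM, fun i hi => ?_⟩,
      fun e he => ?_⟩
    · obtain rfl : i = 0 := by simpa using hi
      simpa using huvM
    · obtain rfl : e = s(u, v) := by simpa using he
      exact Finset.mem_symmDiff.2 (.inr ⟨huvN, huvM⟩)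
  obtain ⟨w, hvwM⟩ : ∃ w, s(v, w) ∈ M := by
    simp only [IsFreeVertex, not_forall, not_not] at hvM
    obtain ⟨e, he, hve⟩ := hvM
    obtain ⟨w, rfl⟩ := Sym2.mem_iff_exists.1 hve
    exact ⟨w, he⟩
  have hvw : G.Adj v w := hM.1 hvwM
  have hvwN : s(v, w) ∉ N := fun h =>
    huvM (hN.eq_of_mem h huvN (w := v) (by simp) (by simp) ▸ hvwM)
  have hMc := Finset.card_erase_add_one hvwM
  have hNc := Finset.card_erase_add_one huvN
  obtain ⟨x, y, q, hq, hqMN⟩ := ih (N.erase s(u, v)).card (by omega)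
    (hM.subset (M.erase_subset s(v, w))) (hN.subset (N.erase_subset s(u, v))) (by omega) rfl
  have havoid : ∀ z, IsFreeVertex (M.erase s(v, w)) z → IsFreeVertex (N.erase s(u, v)) z →
      z ∉ q.support := by
    intro z hzM hzN hz
    obtain ⟨e, he, -, hze⟩ := hq.exists_edge_notMem hz
    rcases Finset.mem_symmDiff.1 (hqMN e he) with h | h
    · exact hzM e h.1 hze
    · exact hzN e h.1 hze
  have huq : u ∉ q.support :=
    havoid u (huM.subset (M.erase_subset _)) (hN.isFreeVertex_erase huvN (by simp))
  have hvq : v ∉ q.support :=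
    havoid v (hM.isFreeVertex_erase hvwM (by simp)) (hN.isFreeVertex_erase huvN (by simp))
  have hfree : ∀ z ∈ q.support, z ≠ w → IsFreeVertex (M.erase s(v, w)) z → IsFreeVertex M z := by
    intro z hz hzw hzM e he hze
    by_cases hev : e = s(v, w)
    · rw [hev, Sym2.mem_iff] at hze
      rcases hze with rfl | rfl
      · exact hvq hz
      · exact hzw rfl
    · exact hzM e (Finset.mem_erase.2 ⟨hev, he⟩) hze
  have hlift : ∀ e ∈ (M.erase s(v, w)) ∆ (N.erase s(u, v)), v ∉ e → e ∈ M ∆ N := by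
    intro e he hve
    have h1 : e ≠ s(v, w) := by rintro rfl; simp at hve
    have h2 : e ≠ s(u, v) := by rintro rfl; simp at hve
    simpa [Finset.mem_symmDiff, h1, h2] using he
  have hve : ∀ e ∈ q.edges, v ∉ e := fun e he hve =>
    hvq (SimpleGraph.Walk.mem_support_of_mem_edges he hve)
  have hprolong : ∀ (z : V) (r : G.Walk w z), IsAugmentingPath G (M.erase s(v, w)) r →
      (∀ z ∈ r.support, z ∈ q.support) → (∀ e ∈ r.edges, e ∈ q.edges) →
      ∃ (u v : V) (q : G.Walk u v), IsAugmentingPath G M q ∧ ∀ e ∈ q.edges, e ∈ M ∆ N := by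
    intro z r hr hrs hre
    refine ⟨u, z, .cons huv (.cons hvw r), IsAugmentingPath.cons_cons hvwM hr huv hvw huM
      (hfree z (hrs z r.end_mem_support) hr.2.1.symm hr.2.2.2.1)
      (fun h => huq (hrs _ h)) (fun h => hvq (hrs _ h)), fun e he => ?_⟩
    simp only [SimpleGraph.Walk.edges_cons, List.mem_cons] at he
    rcases he with rfl | rfl | he
    · exact Finset.mem_symmDiff.2 (.inr ⟨huvN, huvM⟩)
    · exact Finset.mem_symmDiff.2 (.inl ⟨hvwM, hvwN⟩)
    · exact hlift e (hqMN e (hre e he)) (hve e (hre e he))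
  by_cases hxw : x = w
  · subst hxw
    exact hprolong y q hq (fun _ h => h) (fun _ h => h)
  by_cases hyw : y = w
  · subst hyw
    exact hprolong x q.reverse hq.reverse (by simp) (by simp)
  refine ⟨x, y, q, hq.congr (hfree x q.start_mem_support hxw hq.2.2.1)
    (hfree y q.end_mem_support hyw hq.2.2.2.1) fun e he => ?_,
    fun e he => hlift e (hqMN e he) (hve e he)⟩
  have : e ≠ s(v, w) := by rintro rfl; exact hve _ he (by simp)
  simp [this]

/-- If every `M`-augmenting path has length at least `ℓ`, then a matching with `r` more edges
than `M` differs from `M` in at least `r * ℓ` edges. -/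
lemma mul_le_card_symmDiff (hM : IsMatchingOn G M) (hN : IsMatchingOn G N) {ℓ r : ℕ}
    (hℓ : ∀ (u v : V) (q : G.Walk u v), IsAugmentingPath G M q → ℓ ≤ q.length)
    (hcard : N.card = M.card + r) : r * ℓ ≤ (M ∆ N).card := by
  induction r generalizing N with
  | zero => simp
  | succ r ih =>
    obtain ⟨u, v, q, hq, hqMN⟩ := exists_isAugmentingPath_of_card_lt hM hN (by omega)
    obtain ⟨hN', hN'card⟩ := hM.reduce hN hq hqMN
    have hr := ih hN' (by omega)
    have hsub : q.edges.toFinset ⊆ M ∆ N := fun e he => hqMN e (List.mem_toFinset.1 he)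
    rw [← symmDiff_assoc, symmDiff_of_ge hsub] at hr
    have := Finset.card_sdiff_add_card_eq_card hsub
    rw [hq.card_edges] at this
    have := hℓ u v q hq
    rw [add_mul, one_mul]
    omega

/-- Simultaneously augmenting along disjoint augmenting paths gives a matching, with one
more edge for each path. -/
lemma IsMatchingOn.augment_biUnion (hM : IsMatchingOn G M) {ι : Type*} {s t : ι → V}
    (p : ∀ i, G.Walk (s i) (t i)) (haug : ∀ i, IsAugmentingPath G M (p i))
    (hdisj : ∀ i j, i ≠ j → ∀ w : V, w ∈ (p i).support → w ∉ (p j).support) (S : Finset ι) :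
    IsMatchingOn G (M ∆ S.biUnion fun i => (p i).edges.toFinset) ∧
      (M ∆ S.biUnion fun i => (p i).edges.toFinset).card = M.card + S.card := by
  classical
  induction S using Finset.induction_on with
  | empty =>
    rw [Finset.biUnion_empty, ← Finset.bot_eq_empty, symmDiff_bot]
    exact ⟨hM, rfl⟩
  | insert a S ha ih =>
    have hne : ∀ e ∈ S.biUnion fun i => (p i).edges.toFinset, ∀ w ∈ e, w ∉ (p a).support := by
      intro e he w hwe
      obtain ⟨i, hi, he⟩ := Finset.mem_biUnion.1 he
      exact hdisj i a (fun h => ha (h ▸ hi)) w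
        (SimpleGraph.Walk.mem_support_of_mem_edges (List.mem_toFinset.1 he) hwe)
    have hd : Disjoint (S.biUnion fun i => (p i).edges.toFinset) (p a).edges.toFinset := by
      refine Finset.disjoint_left.2 fun e he hea => ?_
      obtain ⟨w, hwe⟩ : ∃ w, w ∈ e := ⟨_, Sym2.out_fst_mem e⟩
      exact hne e he w hwe
        (SimpleGraph.Walk.mem_support_of_mem_edges (List.mem_toFinset.1 hea) hwe)
    have hset : (insert a S).biUnion (fun i => (p i).edges.toFinset) =
        (S.biUnion fun i => (p i).edges.toFinset) ∆ (p a).edges.toFinset := by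
      rw [Finset.biUnion_insert, hd.symmDiff_eq_sup, sup_comm, Finset.sup_eq_union]
    have := ih.1.augment ((haug a).symmDiff_of_disjoint hne)
    rw [hset, ← symmDiff_assoc, Finset.card_insert_of_notMem ha, ← add_assoc, ← ih.2]
    exact this

end Matching

/-- Let `M` be a matching in the finite simple graph `G` whose shortest
`M`-augmenting path has length `ℓ`. If `p 0, …, p (k-1)` is a maximal set of pairwise
vertex-disjoint `M`-augmenting paths of length `ℓ`, and `M'` is the symmetric difference
of `M` with the union of their edge sets, then every `M'`-augmenting path in `G` has
length strictly greater than `ℓ`. -/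
theorem augmenting_paths_lengthen_after_phase [Fintype V] [DecidableEq V]
    (G : SimpleGraph V) (M : Finset (Sym2 V)) (hM : IsMatchingOn G M)
    (ℓ : ℕ)
    (hshort_ex : ∃ (u v : V) (q : G.Walk u v), IsAugmentingPath G M q ∧ q.length = ℓ)
    (hshort_min : ∀ (u v : V) (q : G.Walk u v), IsAugmentingPath G M q → ℓ ≤ q.length)
    (k : ℕ) (s t : Fin k → V) (p : ∀ i, G.Walk (s i) (t i))
    (haug : ∀ i, IsAugmentingPath G M (p i) ∧ (p i).length = ℓ)
    (hdisj : ∀ i j, i ≠ j → ∀ w : V, w ∈ (p i).support → w ∉ (p j).support)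
    (hmaximal : ∀ (u v : V) (q : G.Walk u v), IsAugmentingPath G M q → q.length = ℓ →
      ∃ i, ∃ w : V, w ∈ q.support ∧ w ∈ (p i).support) :
    ∀ (u v : V) (q : G.Walk u v),
      IsAugmentingPath G (M ∆ Finset.univ.biUnion fun i => (p i).edges.toFinset) q →
        ℓ < q.length := by
  intro u v q hq
  by_contra! hle
  set U := Finset.univ.biUnion fun i => (p i).edges.toFinset with hU
  obtain ⟨hM', hM'card⟩ := hM.augment_biUnion p (fun i => (haug i).1) hdisj Finset.univ
  rw [← hU] at hM' hM'card
  obtain ⟨hM'', hM''card⟩ := hM'.augment hq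
  have hlower := mul_le_card_symmDiff (r := k + 1) hM hM'' hshort_min
    (by rw [hM''card, hM'card, Finset.card_fin]; ring)
  rw [symmDiff_assoc, symmDiff_symmDiff_cancel_left] at hlower
  have hUcard : U.card ≤ k * ℓ := by
    refine (Finset.card_biUnion_le_card_mul _ _ ℓ fun i _ => ?_).trans (by simp)
    rw [(haug i).1.card_edges, (haug i).2]
  have hcount := card_symmDiff_add_card_inter U q.edges.toFinset
  have hsplit := Finset.card_sdiff_add_card_inter q.edges.toFinset U
  rw [hq.card_edges] at hsplit
  rw [add_mul, one_mul] at hlower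
  have hlen : q.length = ℓ := by omega
  have hinter : q.edges.toFinset ∩ U = ∅ := Finset.card_eq_zero.1 (by omega)
  have hmemU : ∀ i, ∀ e ∈ (p i).edges, e ∈ U := fun i e he =>
    Finset.mem_biUnion.2 ⟨i, Finset.mem_univ i, List.mem_toFinset.2 he⟩
  have hqp : ∀ i, ∀ w ∈ q.support, w ∉ (p i).support := by
    intro i w hwq hwp
    obtain ⟨e, he, heM, hwe⟩ := (haug i).1.exists_edge_notMem hwp
    have heM' : e ∈ M ∆ U := Finset.mem_symmDiff.2 (.inr ⟨hmemU i e he, heM⟩)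
    rcases hq.isFreeVertex_or_exists_edge_mem hwq with h | ⟨f, hf, hfM', hwf⟩
    · exact h e heM' hwe
    · obtain rfl := hM'.eq_of_mem heM' hfM' hwe hwf
      have : e ∈ q.edges.toFinset ∩ U :=
        Finset.mem_inter.2 ⟨List.mem_toFinset.2 hf, hmemU i e he⟩
      simp [hinter] at this
  have hqM : IsAugmentingPath G M q := by
    have := hq.symmDiff_of_disjoint (F := U) fun e he w hwe hwq => by
      obtain ⟨i, -, hi⟩ := Finset.mem_biUnion.1 he
      exact hqp i w hwq
        (SimpleGraph.Walk.mem_support_of_mem_edges (List.mem_toFinset.1 hi) hwe)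
    rwa [symmDiff_symmDiff_cancel_right] at this
  obtain ⟨i, w, hwq, hwp⟩ := hmaximal u v q hqM hlen
  exact hqp i w hwq hwp
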